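/- arXiv:0906.2935 — 3 statements merged into one kernel-verified Lean document; each statement's English description precedes it below -/
import Mathlib

section
/- Let q̄ be a prime power and let F be a finite field with q̄⁶ elements. The number of triples (x, y, z) ∈ F³ with z ≠ 0 satisfying z^{q̄²−q̄+1} = y·h(x) and x^{q̄} + x = y^{q̄+1} equals q̄³(q̄³+1)(q̄²−1). -/
open Polynomial

/-- A monic polynomial over a finite field that divides `X ^ |F| - X` has as many roots as its
degree. -/
theorem card_filter_eval_eq_zero_of_root_pow_card {F : Type*} [Field F] [Fintype F] [DecidableEq F]
    (P : F[X]) (hP : P.Monic)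
    (h : AdjoinRoot.root P ^ Fintype.card F = AdjoinRoot.root P) :
    (Finset.univ.filter fun x : F => P.eval x = 0).card = P.natDegree := by
  have hdvd : P ∣ X ^ Fintype.card F - X := by
    rw [← AdjoinRoot.mk_eq_zero]
    simp [h]
  have hne : (X ^ Fintype.card F - X : F[X]) ≠ 0 :=
    FiniteField.X_pow_card_sub_X_ne_zero F Fintype.one_lt_card
  have hroots := FiniteField.roots_X_pow_card_sub_X F
  have hsplits : (X ^ Fintype.card F - X : F[X]).Splits := by
    rw [splits_iff_card_roots, hroots,
      FiniteField.X_pow_card_sub_X_natDegree_eq F Fintype.one_lt_card]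
    rfl
  have hnodup : P.roots.Nodup := by
    refine Multiset.nodup_of_le (roots.le_of_dvd hne hdvd) ?_
    rw [hroots]
    exact Finset.univ.nodup
  rw [← splits_iff_card_roots.1 (hsplits.of_dvd hne hdvd), ← Multiset.toFinset_card_of_nodup hnodup]
  congr 1
  ext x
  simp [hP.ne_zero]

/-- Root counting for polynomials over a field with `q ^ 6` elements, `φ` and `ψ` being the
`q`-power maps on the field and on an algebra over it. -/
theorem card_filter_of_frobenius {F : Type*} [Field F] [Fintype F] [DecidableEq F]
    {p e q : ℕ} [CharP F p] (hp : p.Prime) (hq : q = p ^ e) (hF : Fintype.card F = q ^ 6)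
    (φ : F →+* F) (hφ : ∀ x, φ x = x ^ q) (P : F[X]) (hP : P.Monic) {d : ℕ}
    (hd : P.natDegree = d) (Q : F → Prop) [DecidablePred Q] (hQ : ∀ x, Q x ↔ P.eval x = 0)
    (h : ∀ ψ : AdjoinRoot P →+* AdjoinRoot P, (∀ x, ψ x = x ^ q) →
      (∀ c, ψ (algebraMap F _ c) = algebraMap F _ (φ c)) →
      ∀ a, aeval a P = 0 → ψ (ψ (ψ (ψ (ψ (ψ a))))) = a) :
    (Finset.univ.filter Q).card = d := by
  simp only [hQ, ← hd]
  apply card_filter_eval_eq_zero_of_root_pow_card P hP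
  cases subsingleton_or_nontrivial (AdjoinRoot P) with
  | inl _ => exact Subsingleton.elim _ _
  | inr _ =>
    have : Fact p.Prime := ⟨hp⟩
    have : CharP (AdjoinRoot P) p :=
      charP_of_injective_algebraMap (algebraMap F (AdjoinRoot P)).injective p
    have hψ : ∀ x, iterateFrobenius (AdjoinRoot P) p e x = x ^ q := by
      intro x
      rw [iterateFrobenius_def, hq]
    have key := h _ hψ (fun c => by rw [hψ, hφ, map_pow]) (AdjoinRoot.root P) (by simp)
    simp only [hψ, ← pow_mul] at key
    rw [hF]
    convert key using 2
    ring

section Fibers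

variable {F : Type*} [Field F] [Fintype F] [DecidableEq F] {p e q : ℕ} [CharP F p]

theorem card_pow_add_self_eq (hp : p.Prime) (hq : q = p ^ e) (hq1 : 1 < q)
    (hF : Fintype.card F = q ^ 6) (φ : F →+* F) (hφ : ∀ x, φ x = x ^ q) (c : F)
    (hc : c - φ c + φ (φ c) - φ (φ (φ c)) + φ (φ (φ (φ c))) - φ (φ (φ (φ (φ c)))) = 0) :
    (Finset.univ.filter fun x : F => x ^ q + x = c).card = q := by
  have hdeg : (X - C c : F[X]).natDegree < q := by rwa [natDegree_X_sub_C]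
  have hP : (X ^ q + (X - C c) : F[X]).Monic := monic_X_pow_add (by
    rw [degree_X_sub_C]; exact_mod_cast hq1)
  have hn : (X ^ q + (X - C c) : F[X]).natDegree = q := by
    rw [natDegree_add_eq_left_of_natDegree_lt (by simpa using hdeg), natDegree_X_pow]
  refine card_filter_of_frobenius hp hq hF φ hφ _ hP hn _ (fun x => ?_) ?_
  · simp [← add_sub_assoc, sub_eq_zero]
  · intro ψ hψ hψc a ha
    set A := algebraMap F (AdjoinRoot (X ^ q + (X - C c))) with hA
    have h1 : ψ a = A c - a := by
      simp only [map_add, map_sub, map_pow, aeval_X, aeval_C, ← hψ] at ha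
      linear_combination ha
    have hc' := congrArg A hc
    simp only [map_add, map_sub, map_zero] at hc'
    simp only [h1, map_sub, hψc]
    linear_combination -hc'

theorem card_pow_sq_sub_self_eq (hp : p.Prime) (hq : q = p ^ e) (hq1 : 1 < q)
    (hF : Fintype.card F = q ^ 6) (φ : F →+* F) (hφ : ∀ x, φ x = x ^ q) (w : F)
    (hw : w + φ (φ w) + φ (φ (φ (φ w))) = 0) :
    (Finset.univ.filter fun y : F => φ (φ y) - y = w).card = q ^ 2 := by
  have hq2 : 1 < q ^ 2 := Nat.one_lt_pow two_ne_zero hq1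
  have hP : (X ^ q ^ 2 - (X + C w) : F[X]).Monic := monic_X_pow_sub (by
    rw [degree_X_add_C]; exact_mod_cast hq2)
  have hn : (X ^ q ^ 2 - (X + C w) : F[X]).natDegree = q ^ 2 := by
    rw [natDegree_sub_eq_left_of_natDegree_lt (by rw [natDegree_X_add_C, natDegree_X_pow]; exact hq2),
      natDegree_X_pow]
  refine card_filter_of_frobenius hp hq hF φ hφ _ hP hn _ (fun x => ?_) ?_
  · simp [← sub_sub, sub_eq_zero, hφ, ← pow_mul, ← sq]
  · intro ψ hψ hψc a ha
    set A := algebraMap F (AdjoinRoot (X ^ q ^ 2 - (X + C w))) with hA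
    have h1 : ψ (ψ a) = A w + a := by
      simp only [map_add, map_sub, map_pow, aeval_X, aeval_C, sq q, pow_mul, ← hψ] at ha
      linear_combination ha
    have hw' := congrArg A hw
    simp only [map_add, map_zero] at hw'
    simp only [h1, map_add, hψc]
    linear_combination hw'

theorem card_pow_eq (hp : p.Prime) (hq : q = p ^ e)
    (hF : Fintype.card F = q ^ 6) (φ : F →+* F) (hφ : ∀ x, φ x = x ^ q) {n : ℕ} (hn0 : n ≠ 0)
    (hn : n * (q + 1) = q ^ 3 + 1) (w : F) (hw0 : w ≠ 0)
    (hw : φ (φ (φ (w * φ w))) = w * φ w) :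
    (Finset.univ.filter fun z : F => z ^ n = w).card = n := by
  refine card_filter_of_frobenius hp hq hF φ hφ _ (monic_X_pow_sub_C w hn0)
    natDegree_X_pow_sub_C _ (fun z => ?_) ?_
  · simp [sub_eq_zero]
  · intro ψ hψ hψc a ha
    set A := algebraMap F (AdjoinRoot (X ^ n - C w)) with hA
    have h1 : a ^ n = A w := by
      simpa only [map_sub, map_pow, aeval_X, aeval_C, sub_eq_zero] using ha
    have hunit : IsUnit a := by
      rw [← isUnit_pow_iff hn0, h1]
      exact (IsUnit.mk0 w hw0).map A
    have h2 : a * ψ (ψ (ψ a)) = A (w * φ w) := by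
      rw [map_mul, ← hψc, ← h1]
      simp only [hψ, ← pow_mul, ← pow_succ', ← pow_add]
      congr 1
      linarith
    have h3 : ψ (ψ (ψ (a * ψ (ψ (ψ a))))) = a * ψ (ψ (ψ a)) := by
      rw [h2, hψc, hψc, hψc, hw]
    simp only [map_mul] at h3
    have hunit' : IsUnit (ψ (ψ (ψ a))) := ((hunit.map ψ).map ψ).map ψ
    apply hunit'.mul_left_cancel
    linear_combination h3

theorem card_pow_succ_eq_one (hp : p.Prime) (hq : q = p ^ e)
    (hF : Fintype.card F = q ^ 6) (φ : F →+* F) (hφ : ∀ x, φ x = x ^ q) :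
    (Finset.univ.filter fun u : F => u * φ u = 1).card = q + 1 := by
  refine card_filter_of_frobenius hp hq hF φ hφ _ (monic_X_pow_sub_C 1 (by lia))
    natDegree_X_pow_sub_C _ (fun u => ?_) ?_
  · simp [sub_eq_zero, pow_succ', hφ]
  · intro ψ hψ hψc a ha
    have h1 : a * ψ a = 1 := by
      simpa [sub_eq_zero, pow_succ', hψ] using ha
    have h2 : ψ (ψ a) = a := by
      have h2 : ψ a * ψ (ψ a) = 1 := by simpa only [map_mul, map_one] using congrArg ψ h1
      linear_combination a * h2 - ψ (ψ a) * h1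
    simp only [h2]

theorem card_linearized_eq_zero (hp : p.Prime) (hq : q = p ^ e) (hq1 : 1 < q)
    (hF : Fintype.card F = q ^ 6) (φ : F →+* F) (hφ : ∀ x, φ x = x ^ q) (u : F)
    (hu : u * φ u = 1) :
    (Finset.univ.filter fun w : F => φ (φ w) + φ u * φ w + w = 0).card = q ^ 2 := by
  have hqq : q < q ^ 2 := by nlinarith
  have hdeg : (C (φ u) * X ^ q + X : F[X]).natDegree ≤ q := by
    compute_degree
    exact max_le le_rfl hq1.le
  have hP : (X ^ q ^ 2 + (C (φ u) * X ^ q + X) : F[X]).Monic := monic_X_pow_add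
    (degree_le_natDegree.trans_lt (by exact_mod_cast hdeg.trans_lt hqq))
  have hn : (X ^ q ^ 2 + (C (φ u) * X ^ q + X) : F[X]).natDegree = q ^ 2 := by
    rw [natDegree_add_eq_left_of_natDegree_lt (by rw [natDegree_X_pow]; exact hdeg.trans_lt hqq),
      natDegree_X_pow]
  refine card_filter_of_frobenius hp hq hF φ hφ _ hP hn _ (fun x => ?_) ?_
  · simp [hφ, ← pow_mul, ← sq, add_assoc]
  · intro ψ hψ hψc a ha
    set A := algebraMap F (AdjoinRoot (X ^ q ^ 2 + (C (φ u) * X ^ q + X))) with hA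
    have hu2 : φ (φ u) = u := by
      have h2 := congrArg φ hu
      rw [map_mul, map_one] at h2
      linear_combination u * h2 - φ (φ u) * hu
    have h1 : ψ (ψ a) + A (φ u) * ψ a + a = 0 := by
      simp only [map_add, map_mul, map_pow, aeval_X, aeval_C, sq q, pow_mul, ← hψ] at ha
      linear_combination ha
    have huA : A u * A (φ u) = 1 := by rw [← map_mul, hu, map_one]
    have h3 : ψ (ψ (ψ a)) = A u * a := by
      have h2 := congrArg ψ h1
      simp only [map_add, map_mul, map_zero, hψc, hu2] at h2
      linear_combination h2 - A u * h1 + ψ a * huA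
    rw [h3]
    simp only [map_mul, hψc, hu2, h3]
    linear_combination a * huA

end Fibers

theorem Finset.card_eq_mul_of_card_fiber {α β : Type*} [DecidableEq β] (s : Finset α)
    (t : Finset β) (f : α → β) (k : ℕ) (hf : ∀ a ∈ s, f a ∈ t)
    (hk : ∀ b ∈ t, (s.filter fun a => f a = b).card = k) : s.card = t.card * k := by
  rw [Finset.card_eq_sum_card_fiberwise hf, Finset.sum_congr rfl hk, Finset.sum_const,
    smul_eq_mul]

section Count

variable {F : Type*} [Field F] [Fintype F] [DecidableEq F] {p e q : ℕ} [CharP F p]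

theorem card_trace_zero_norm_fixed (hp : p.Prime) (hq : q = p ^ e) (hq1 : 1 < q)
    (hF : Fintype.card F = q ^ 6) (φ : F →+* F) (hφ : ∀ x, φ x = x ^ q) :
    (Finset.univ.filter fun w : F => w ≠ 0 ∧ w + φ (φ w) + φ (φ (φ (φ w))) = 0 ∧
      φ (φ (φ (w * φ w))) = w * φ w).card = (q + 1) * (q ^ 2 - 1) := by
  rw [← card_pow_succ_eq_one hp hq hF φ hφ]
  apply Finset.card_eq_mul_of_card_fiber _ _ fun w => φ (φ (φ w)) / w
  · simp only [Finset.mem_filter, Finset.mem_univ, true_and]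
    rintro w ⟨h0, -, h⟩
    have h0' : φ w ≠ 0 := by simpa using h0
    simp only [map_mul, map_div₀] at h ⊢
    field_simp
    exact h
  · intro u hu
    simp only [Finset.mem_filter, Finset.mem_univ, true_and] at hu
    have hu2 : φ (φ u) = u := by
      have h2 := congrArg φ hu
      rw [map_mul, map_one] at h2
      linear_combination u * h2 - φ (φ u) * hu
    rw [← card_linearized_eq_zero hp hq hq1 hF φ hφ u hu,
      ← Finset.card_erase_of_mem (a := (0 : F)) (by simp)]
    congr 1
    ext w
    simp only [Finset.mem_filter, Finset.mem_univ, true_and, Finset.mem_erase]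
    constructor
    · rintro ⟨⟨h0, h1, h2⟩, h3⟩
      refine ⟨h0, ?_⟩
      have h4 : φ (φ (φ w)) = u * w := by rw [← h3]; field_simp
      rw [h4, map_mul] at h1
      linear_combination h1
    · rintro ⟨h0, h1⟩
      have h4 : φ (φ (φ w)) = u * w := by
        have h2 := congrArg φ h1
        simp only [map_add, map_mul, map_zero, hu2] at h2
        linear_combination h2 - u * h1 + φ w * hu
      refine ⟨⟨h0, ?_, ?_⟩, ?_⟩
      · rw [h4, map_mul]
        linear_combination h1
      · simp only [map_mul, h4]
        linear_combination w * φ w * hu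
      · rw [h4]
        field_simp

theorem card_second_coordinates (hp : p.Prime) (hq : q = p ^ e) (hq1 : 1 < q)
    (hF : Fintype.card F = q ^ 6) (φ : F →+* F) (hφ : ∀ x, φ x = x ^ q)
    (hφ6 : ∀ x, φ (φ (φ (φ (φ (φ x))))) = x) :
    (Finset.univ.filter fun y : F => φ (φ y) - y ≠ 0 ∧
      φ (φ (φ ((φ (φ y) - y) * φ (φ (φ y) - y)))) = (φ (φ y) - y) * φ (φ (φ y) - y)).card
      = (q + 1) * (q ^ 2 - 1) * q ^ 2 := by
  rw [← card_trace_zero_norm_fixed hp hq hq1 hF φ hφ]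
  apply Finset.card_eq_mul_of_card_fiber _ _ fun y => φ (φ y) - y
  · simp only [Finset.mem_filter, Finset.mem_univ, true_and]
    rintro y ⟨h0, h⟩
    refine ⟨h0, ?_, h⟩
    simp only [map_sub, hφ6]
    ring
  · intro w hw
    simp only [Finset.mem_filter, Finset.mem_univ, true_and] at hw
    rw [← card_pow_sq_sub_self_eq hp hq hq1 hF φ hφ w hw.2.1]
    congr 1
    ext y
    simp only [Finset.mem_filter, Finset.mem_univ, true_and, and_iff_right_iff_imp]
    rintro rfl
    exact ⟨hw.1, hw.2.2⟩

theorem card_points (hp : p.Prime) (hq : q = p ^ e) (hq1 : 1 < q)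
    (hF : Fintype.card F = q ^ 6) (φ : F →+* F) (hφ : ∀ x, φ x = x ^ q)
    (hφ6 : ∀ x, φ (φ (φ (φ (φ (φ x))))) = x) {n : ℕ} (hn0 : n ≠ 0)
    (hn : n * (q + 1) = q ^ 3 + 1) :
    (Finset.univ.filter fun v : F × F × F => v.2.2 ≠ 0 ∧ v.2.2 ^ n = φ (φ v.2.1) - v.2.1 ∧
      v.1 ^ q + v.1 = v.2.1 * φ v.2.1).card = (q + 1) * (q ^ 2 - 1) * q ^ 2 * (q * n) := by
  rw [← card_second_coordinates hp hq hq1 hF φ hφ hφ6]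
  apply Finset.card_eq_mul_of_card_fiber _ _ fun v => v.2.1
  · simp only [Finset.mem_filter, Finset.mem_univ, true_and]
    rintro ⟨x, y, z⟩ ⟨h0, h, -⟩
    dsimp only at h0 h ⊢
    rw [← h]
    refine ⟨pow_ne_zero _ h0, ?_⟩
    have h2 : z ^ n * φ (z ^ n) = z * φ (φ (φ z)) := by
      simp only [hφ, ← pow_mul, ← pow_succ', ← pow_add]
      congr 1
      linarith
    rw [h2]
    simp only [map_mul, hφ6]
    ring
  · intro y hy
    simp only [Finset.mem_filter, Finset.mem_univ, true_and] at hy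
    obtain ⟨h0, h⟩ := hy
    have hz := card_pow_eq hp hq hF φ hφ hn0 hn _ h0 h
    have hx := card_pow_add_self_eq hp hq hq1 hF φ hφ (y * φ y) (by
      simp only [map_mul, map_sub, hφ6] at h ⊢
      linear_combination -h)
    refine Eq.trans ?_ ((Finset.card_product _ _).trans (congrArg₂ (· * ·) hx hz))
    refine Finset.card_bij' (fun v _ => (v.1, v.2.2)) (fun v _ => (v.1, y, v.2)) ?_ ?_ ?_ ?_
    · simp only [Finset.mem_filter, Finset.mem_univ, true_and, Finset.mem_product]
      rintro ⟨x, y, z⟩ ⟨⟨h0, h1, h2⟩, rfl⟩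
      exact ⟨h2, h1⟩
    · simp only [Finset.mem_filter, Finset.mem_univ, true_and, Finset.mem_product]
      rintro ⟨x, z⟩ ⟨h1, h2⟩
      refine ⟨⟨?_, h2, h1⟩, trivial⟩
      rintro rfl
      rw [zero_pow hn0] at h2
      exact h0 h2.symm
    · simp only [Finset.mem_filter, Finset.mem_univ, true_and]
      rintro ⟨x, y, z⟩ ⟨-, rfl⟩
      rfl
    · simp

end Count

/-- On the Hermitian curve `x ^ q + x = y ^ (q + 1)` the function `y * h(x)` equals
`y ^ (q ^ 2) - y`. -/
theorem mul_alternating_sum_eq {F : Type*} [Field F] {q : ℕ} (hq1 : 1 < q)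
    (φ : F →+* F) (hφ : ∀ x, φ x = x ^ q) (x y : F) (hxy : x ^ q + x = y * φ y) :
    y * ∑ i ∈ Finset.range (q + 1), (-1 : F) ^ (i + 1) * x ^ (i * (q - 1)) = φ (φ y) - y := by
  obtain rfl | hy := eq_or_ne y 0
  · simp
  have hy' : φ y ≠ 0 := by simpa using hy
  have hsum : ∑ i ∈ Finset.range (q + 1), (-1 : F) ^ (i + 1) * x ^ (i * (q - 1))
      = -∑ i ∈ Finset.range (q + 1), (-x ^ (q - 1)) ^ i := by
    rw [← Finset.sum_neg_distrib]
    refine Finset.sum_congr rfl fun i _ => ?_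
    rw [neg_pow (x ^ (q - 1)), ← pow_mul, mul_comm (q - 1)]
    ring
  have hgeom := geom_sum_mul_neg (-x ^ (q - 1)) (q + 1)
  have hxq : x ^ (q - 1) * x = φ x := by
    rw [hφ, ← pow_succ, Nat.sub_add_cancel hq1.le]
  have hxx : (-x ^ (q - 1)) ^ (q + 1) * x = φ (φ x) := by
    have hx2 : x ^ (q - 1) * φ (x ^ (q - 1)) * x = φ (φ x) := by
      rw [← hxq, map_mul, ← hxq]
      ring
    rw [pow_succ, ← hφ, map_neg, ← hx2]
    ring
  have hfx : φ x + x = y * φ y := by rw [hφ, hxy]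
  have hffx := congrArg φ hfx
  rw [map_add, map_mul] at hffx
  rw [hsum]
  apply mul_right_cancel₀ (mul_ne_zero hy hy')
  set S := ∑ i ∈ Finset.range (q + 1), (-x ^ (q - 1)) ^ i
  linear_combination (y * S) * hfx - y * x * hgeom + y * S * hxq + y * hxx + y * hffx - y * hfx


theorem gk_curve_affine_nonzero_z_count
    (q : ℕ) (hq : ∃ p e : ℕ, p.Prime ∧ 1 ≤ e ∧ q = p ^ e)
    (F : Type*) [Field F] [Fintype F] (hF : Fintype.card F = q ^ 6) :
    {v : F × F × F | v.2.2 ≠ 0 ∧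
        v.2.2 ^ (q ^ 2 - q + 1)
          = v.2.1 * ∑ i ∈ Finset.range (q + 1), (-1 : F) ^ (i + 1) * v.1 ^ (i * (q - 1)) ∧
        v.1 ^ q + v.1 = v.2.1 ^ (q + 1)}.ncard
      = q ^ 3 * (q ^ 3 + 1) * (q ^ 2 - 1) := by
  classical
  obtain ⟨p, e, hp, he, hqe⟩ := hq
  have : Fact p.Prime := ⟨hp⟩
  have hq1 : 1 < q := hqe ▸ Nat.one_lt_pow (by lia) hp.one_lt
  have : CharP F p := by
    have h : Fintype.card F = p ^ (e * 6) := by rw [hF, hqe, pow_mul]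
    exact charP_of_card_eq_prime_pow h
  have hφ : ∀ x, iterateFrobenius F p e x = x ^ q := by
    intro x
    rw [iterateFrobenius_def, hqe]
  generalize iterateFrobenius F p e = φ at hφ
  have hφ6 : ∀ x, φ (φ (φ (φ (φ (φ x))))) = x := by
    intro x
    simp only [hφ, ← pow_mul]
    conv_rhs => rw [← FiniteField.pow_card x, hF]
    ring
  have hn : (q ^ 2 - q + 1) * (q + 1) = q ^ 3 + 1 := by
    have hle : q ≤ q ^ 2 := by nlinarith
    zify [hle]
    ring
  have hset : {v : F × F × F | v.2.2 ≠ 0 ∧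
        v.2.2 ^ (q ^ 2 - q + 1)
          = v.2.1 * ∑ i ∈ Finset.range (q + 1), (-1 : F) ^ (i + 1) * v.1 ^ (i * (q - 1)) ∧
        v.1 ^ q + v.1 = v.2.1 ^ (q + 1)} =
      ↑(Finset.univ.filter fun v : F × F × F => v.2.2 ≠ 0 ∧
        v.2.2 ^ (q ^ 2 - q + 1) = φ (φ v.2.1) - v.2.1 ∧
        v.1 ^ q + v.1 = v.2.1 * φ v.2.1) := by
    ext ⟨x, y, z⟩
    simp only [Set.mem_ofPred_eq, Finset.coe_filter, Finset.mem_univ, true_and, hφ y, ← pow_succ']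
    refine and_congr_right fun _ => and_congr_left fun hxy => ?_
    rw [mul_alternating_sum_eq hq1 φ hφ x y (by rw [hxy, hφ, pow_succ']), hφ y]
  rw [hset, Set.ncard_coe_finset, card_points hp hqe hq1 hF φ hφ hφ6 (by lia) hn, ← hn]
  ring
end

section
/- Let F be a finite field with 64 elements. There exists an F-linear subspace C of F^{224} of dimension at least 201 such that every nonzero element of C has Hamming weight at least 15; i.e., a linear [224, 201, ≥15]-code over F_{64} exists. -/
namespace GKCode

open Polynomial

/-- The monomial `x ^ i * y ^ j * z ^ k`, with exponents `e = (i, j, k)`, at a point. -/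
def mon {F : Type*} [Field F] (p : F × F × F) (e : ℕ × ℕ × ℕ) : F :=
  p.1 ^ e.1 * p.2.1 ^ e.2.1 * p.2.2 ^ e.2.2

/-- The pole order at infinity of a monomial on the GK curve. -/
def weight (e : ℕ × ℕ × ℕ) : ℕ := 9 * e.1 + 6 * e.2.1 + 8 * e.2.2

/-- The affine equations of the GK curve with parameter `2`. -/
def OnCurve {F : Type*} [Field F] (p : F × F × F) : Prop :=
  p.1 ^ 2 + p.1 = p.2.1 ^ 3 ∧ p.2.1 ^ 4 + p.2.1 = p.2.2 ^ 3

/-- The gaps of the numerical semigroup generated by `6`, `8` and `9`. -/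
def gaps : Finset ℕ := {1, 2, 3, 4, 5, 7, 10, 11, 13, 19}

/-- The pole orders that can be written in fewer than `15` ways as an ordered sum of two
pole orders. -/
def checks : Finset ℕ :=
  {0, 6, 8, 9, 12, 14, 15, 16, 17, 18, 20, 21, 22, 23, 24, 25, 26, 27, 28, 29, 30, 31, 33}

/-- Exponents of a monomial with a prescribed pole order. -/
def exponents (a : ℕ) : ℕ × ℕ × ℕ :=
  (a % 2, (a - 9 * (a % 2) - 8 * (2 * a % 3)) / 6, 2 * a % 3)

lemma weight_exponents {a : ℕ} (ha : a ∉ gaps) : weight (exponents a) = a := by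
  simp only [gaps, Finset.mem_insert, Finset.mem_singleton] at ha
  simp only [weight, exponents]
  have h : a % 6 < 6 := Nat.mod_lt _ (by norm_num)
  interval_cases hr : a % 6
  · rw [show a % 2 = 0 by omega, show 2 * a % 3 = 0 by omega]; omega
  · rw [show a % 2 = 1 by omega, show 2 * a % 3 = 2 by omega]; omega
  · rw [show a % 2 = 0 by omega, show 2 * a % 3 = 1 by omega]; omega
  · rw [show a % 2 = 1 by omega, show 2 * a % 3 = 0 by omega]; omega
  · rw [show a % 2 = 0 by omega, show 2 * a % 3 = 2 by omega]; omega
  · rw [show a % 2 = 1 by omega, show 2 * a % 3 = 1 by omega]; omega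

lemma weight_notMem_gaps (e : ℕ × ℕ × ℕ) : weight e ∉ gaps := by
  simp only [gaps, Finset.mem_insert, Finset.mem_singleton, weight]
  omega

set_option maxRecDepth 10000 in
lemma exists_fifteen_decompositions {n : ℕ} (hg : n ∉ gaps) (hc : n ∉ checks) :
    ∃ A : Finset ℕ, 15 ≤ A.card ∧ ∀ a ∈ A, a ≤ n ∧ a ∉ gaps ∧ n - a ∉ gaps := by
  by_cases hn : n < 44
  · refine ⟨(Finset.range (n + 1)).filter fun a => a ∉ gaps ∧ n - a ∉ gaps, ?_, ?_⟩
    · have h : ∀ n < 44, n ∉ gaps → n ∉ checks → 15 ≤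
          ((Finset.range (n + 1)).filter fun a => a ∉ gaps ∧ n - a ∉ gaps).card := by
        decide
      exact h n hn hg hc
    · intro a ha
      simp only [Finset.mem_filter, Finset.mem_range] at ha
      exact ⟨by omega, ha.2⟩
  · refine ⟨{0, 6, 8, 9, 12, 14, 15, 16, 17, 18, 20, 21, 22, 23, 24}, by decide, ?_⟩
    intro a ha
    have h : a ≤ 24 ∧ a ∉ gaps := by
      revert a
      decide
    refine ⟨by omega, h.2, ?_⟩
    simp only [gaps, Finset.mem_insert, Finset.mem_singleton]
    omega

lemma mon_mul {F : Type*} [Field F] (p : F × F × F) (e e' : ℕ × ℕ × ℕ) :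
    mon p e * mon p e' = mon p (e + e') := by
  simp only [mon, Prod.fst_add, Prod.snd_add, pow_add]
  ring

lemma weight_add (e e' : ℕ × ℕ × ℕ) : weight (e + e') = weight e + weight e' := by
  simp only [weight, Prod.fst_add, Prod.snd_add]
  ring

section Separation

variable {F ι : Type*} [Field F] [Fintype F] [DecidableEq F] [Fintype ι]

lemma sum_fiber_eq_zero (a x : ι → F) (h : ∀ i : ℕ, ∑ t, a t * x t ^ i = 0) (v : F) :
    ∑ t, a t * (if x t = v then 1 else 0) = 0 := by
  have hp (p : F[X]) : ∑ t, a t * p.eval (x t) = 0 := by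
    simp only [eval_eq_sum_range, Finset.mul_sum]
    rw [Finset.sum_comm]
    refine Finset.sum_eq_zero fun i _ => ?_
    rw [← mul_zero (p.coeff i), ← h i, Finset.mul_sum]
    exact Finset.sum_congr rfl fun t _ => by ring
  refine Eq.trans ?_ (hp (1 - (X - C v) ^ (Fintype.card F - 1)))
  refine Finset.sum_congr rfl fun t _ => ?_
  simp only [eval_sub, eval_one, eval_pow, eval_X, eval_C]
  split_ifs with hx
  · have : Fintype.card F - 1 ≠ 0 := by have := Fintype.one_lt_card (α := F); omega
    simp [hx, this]
  · rw [FiniteField.pow_card_sub_one_eq_one _ (sub_ne_zero.2 hx), sub_self]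

lemma eq_zero_of_forall_sum_mon_eq_zero {P : ι → F × F × F} (hP : Function.Injective P)
    (c : ι → F) (h : ∀ e, ∑ t, c t * mon (P t) e = 0) : c = 0 := by
  have hx (u : F) (j k : ℕ) :
      ∑ t, c t * (if (P t).1 = u then 1 else 0) * (P t).2.2 ^ k * (P t).2.1 ^ j = 0 := by
    refine Eq.trans ?_
      (sum_fiber_eq_zero (fun t => c t * (P t).2.2 ^ k * (P t).2.1 ^ j) (fun t => (P t).1) ?_ u)
    · exact Finset.sum_congr rfl fun t _ => by ring
    · intro i
      rw [← h (i, j, k)]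
      exact Finset.sum_congr rfl fun t _ => by simp only [mon]; ring
  have hy (u v : F) (k : ℕ) : ∑ t, c t * (if (P t).1 = u then 1 else 0) *
      (if (P t).2.1 = v then 1 else 0) * (P t).2.2 ^ k = 0 := by
    refine Eq.trans ?_ (sum_fiber_eq_zero _ (fun t => (P t).2.1) (fun j => hx u j k) v)
    exact Finset.sum_congr rfl fun t _ => by ring
  funext s
  refine Eq.trans ?_
    (sum_fiber_eq_zero _ (fun t => (P t).2.2) (fun k => hy (P s).1 (P s).2.1 k) (P s).2.2)
  rw [Finset.sum_eq_single s]
  · simp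
  · intro t _ hts
    have : P t ≠ P s := fun h => hts (hP h)
    split_ifs with h₁ h₂ h₃ <;> simp
    exact (this (Prod.ext h₁ (Prod.ext h₂ h₃))).elim
  · simp

end Separation

section FengRao

variable {F ι : Type*} [Field F] [Fintype ι]

lemma sum_mon_eq_normalForm {P : ι → F × F × F} (hP : ∀ t, OnCurve (P t)) (c : ι → F) {n : ℕ}
    (hlow : ∀ e, weight e < n → ∑ t, c t * mon (P t) e = 0) (i k : ℕ) :
    ∀ j, weight (i, j, k) = n → ∑ t, c t * mon (P t) (i, j, k) =
      ∑ t, c t * mon (P t) (i % 2, j + 3 * (i / 2) + 4 * (k / 3), k % 3) := by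
  induction i using Nat.strong_induction_on generalizing k with
  | _ i ihi =>
    intro j hw
    by_cases hi : 2 ≤ i
    · obtain ⟨i, rfl⟩ := Nat.exists_eq_add_of_le' hi
      have h : ∑ t, c t * mon (P t) (i + 2, j, k) =
          ∑ t, c t * mon (P t) (i, j + 3, k) - ∑ t, c t * mon (P t) (i + 1, j, k) := by
        rw [← Finset.sum_sub_distrib]
        refine Finset.sum_congr rfl fun t _ => ?_
        simp only [mon]
        linear_combination c t * (P t).1 ^ i * (P t).2.1 ^ j * (P t).2.2 ^ k * (hP t).1
      simp only [weight] at hw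
      rw [h, hlow (i + 1, j, k) (by simp only [weight]; omega), sub_zero,
        ihi i (by omega) k (j + 3) (by simp only [weight]; omega)]
      rw [show (i + 2) % 2 = i % 2 by omega,
        show j + 3 * ((i + 2) / 2) + 4 * (k / 3) = j + 3 + 3 * (i / 2) + 4 * (k / 3) by omega]
    · induction k using Nat.strong_induction_on generalizing j with
      | _ k ihk =>
        by_cases hk : 3 ≤ k
        · obtain ⟨k, rfl⟩ := Nat.exists_eq_add_of_le' hk
          have h : ∑ t, c t * mon (P t) (i, j, k + 3) =
              ∑ t, c t * mon (P t) (i, j + 4, k) + ∑ t, c t * mon (P t) (i, j + 1, k) := by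
            rw [← Finset.sum_add_distrib]
            refine Finset.sum_congr rfl fun t _ => ?_
            simp only [mon]
            linear_combination -c t * (P t).1 ^ i * (P t).2.1 ^ j * (P t).2.2 ^ k * (hP t).2
          simp only [weight] at hw
          rw [h, hlow (i, j + 1, k) (by simp only [weight]; omega), add_zero,
            ihk k (by omega) (j + 4) (by simp only [weight]; omega)]
          rw [show (k + 3) % 3 = k % 3 by omega,
            show j + 3 * (i / 2) + 4 * ((k + 3) / 3) = j + 4 + 3 * (i / 2) + 4 * (k / 3) by omega]
        · rw [show i % 2 = i by omega, show k % 3 = k by omega,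
            show j + 3 * (i / 2) + 4 * (k / 3) = j by omega]

lemma sum_mon_eq_of_weight_eq {P : ι → F × F × F} (hP : ∀ t, OnCurve (P t)) (c : ι → F) {n : ℕ}
    (hlow : ∀ e, weight e < n → ∑ t, c t * mon (P t) e = 0) {e e' : ℕ × ℕ × ℕ}
    (he : weight e = n) (he' : weight e' = n) :
    ∑ t, c t * mon (P t) e = ∑ t, c t * mon (P t) e' := by
  obtain ⟨i, j, k⟩ := e
  obtain ⟨i', j', k'⟩ := e'
  rw [sum_mon_eq_normalForm hP c hlow i k j he, sum_mon_eq_normalForm hP c hlow i' k' j' he']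
  simp only [weight] at he he'
  rw [show i % 2 = i' % 2 by omega, show k % 3 = k' % 3 by omega,
    show j + 3 * (i / 2) + 4 * (k / 3) = j' + 3 * (i' / 2) + 4 * (k' / 3) by omega]

/-- The Feng–Rao bound: if `n` is the least pole order at which `c` has a nonzero syndrome, then
the weight of `c` is at least the number of decompositions of `n` into two pole orders. -/
lemma card_le_hammingNorm [DecidableEq F] {P : ι → F × F × F} (hP : ∀ t, OnCurve (P t))
    (c : ι → F) {n : ℕ} (hlow : ∀ e, weight e < n → ∑ t, c t * mon (P t) e = 0)
    {e₀ : ℕ × ℕ × ℕ} (he₀ : weight e₀ = n) (hne : ∑ t, c t * mon (P t) e₀ ≠ 0)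
    (A : Finset ℕ) (hA : ∀ a ∈ A, a ≤ n ∧ a ∉ gaps ∧ n - a ∉ gaps) :
    A.card ≤ hammingNorm c := by
  let v : A → ({t // c t ≠ 0} → F) := fun a t => mon (P t) (exponents a)
  have hv : LinearIndependent F v := by
    rw [Fintype.linearIndependent_iff]
    intro g hg
    by_contra! hg0
    obtain ⟨a₀, ha₀⟩ := hg0
    obtain ⟨m, hm, hmax⟩ := (Finset.univ.filter fun a => g a ≠ 0).exists_max_image
      (fun a : A => (a : ℕ)) ⟨a₀, by simpa using ha₀⟩
    simp only [Finset.mem_filter, Finset.mem_univ, true_and] at hm hmax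
    obtain ⟨hmn, hmg, hnm⟩ := hA m m.2
    have hrel (t : ι) : c t * ∑ a, g a * mon (P t) (exponents a) = 0 := by
      by_cases ht : c t = 0
      · rw [ht, zero_mul]
      · have := congrFun hg ⟨t, ht⟩
        simp only [Finset.sum_apply, Pi.smul_apply, smul_eq_mul, Pi.zero_apply, v] at this
        rw [this, mul_zero]
    have hsum : ∑ a, g a * ∑ t, c t * mon (P t) (exponents a + exponents (n - m)) = 0 := by
      simp only [Finset.mul_sum]
      rw [Finset.sum_comm]
      refine Finset.sum_eq_zero fun t _ => ?_
      rw [← zero_mul (mon (P t) (exponents (n - m))), ← hrel t, Finset.mul_sum, Finset.sum_mul]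
      exact Finset.sum_congr rfl fun a _ => by rw [← mon_mul]; ring
    rw [Finset.sum_eq_single m] at hsum
    · refine hne ?_
      rw [sum_mon_eq_of_weight_eq hP c hlow he₀ (e' := exponents m + exponents (n - m))]
      · exact (mul_eq_zero.1 hsum).resolve_left hm
      · rw [weight_add, weight_exponents hmg, weight_exponents hnm]
        omega
    · intro a _ ham
      by_cases hga : g a = 0
      · rw [hga, zero_mul]
      · have h₁ := hmax a hga
        have h₂ : (a : ℕ) ≠ m := fun h => ham (Subtype.ext h)
        rw [hlow, mul_zero]
        rw [weight_add, weight_exponents (hA a a.2).2.1, weight_exponents hnm]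
        omega
    · simp
  have := hv.fintype_card_le_finrank
  rw [Module.finrank_fintype_fun_eq_card, Fintype.card_coe, Fintype.card_subtype] at this
  exact this

end FengRao

section Points

variable {F : Type*} [Field F] [Fintype F] [DecidableEq F]

lemma card_sub_natDegree_le_card_filter {q : F[X]} (hq : q ≠ 0) :
    Fintype.card F - q.natDegree ≤ (Finset.univ.filter fun z => q.eval z ≠ 0).card := by
  have h₁ : (Finset.univ.filter fun z => q.eval z = 0).card ≤ q.natDegree := by
    refine (Finset.card_le_card fun z hz => ?_).trans
      ((Multiset.toFinset_card_le _).trans q.card_roots')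
    simpa [hq] using hz
  have h₂ := Finset.card_filter_add_card_filter_not (s := (Finset.univ : Finset F))
    (fun z => q.eval z = 0)
  rw [Finset.card_univ] at h₂
  simp only [ne_eq]
  omega

omit [DecidableEq F] in
lemma two_eq_zero (hF : Fintype.card F = 64) : (2 : F) = 0 := by
  have h := Nat.cast_card_eq_zero F
  rw [hF] at h
  refine pow_eq_zero_iff (n := 6) (by norm_num) |>.1 ?_
  rw [← h]
  norm_num

lemma exists_primitive_cube_root (hF : Fintype.card F = 64) : ∃ w : F, w ^ 2 + w + 1 = 0 := by
  have hdeg : (X ^ 22 - X : F[X]).natDegree = 22 := by compute_degree!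
  have hq : (X ^ 22 - X : F[X]) ≠ 0 := fun h => by simp [h] at hdeg
  have hcard := card_sub_natDegree_le_card_filter hq
  rw [hF, hdeg] at hcard
  obtain ⟨x, hx⟩ := Finset.card_pos.1 (lt_of_lt_of_le (by norm_num) hcard)
  simp only [Finset.mem_filter, Finset.mem_univ, true_and, eval_sub, eval_pow, eval_X] at hx
  have hx64 := FiniteField.pow_card x
  rw [hF] at hx64
  refine ⟨x ^ 21, (mul_eq_zero.1 (?_ : (x ^ 22 - x) * _ = 0)).resolve_left hx⟩
  linear_combination hx64

lemma exists_third_coordinates (hF : Fintype.card F = 64) :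
    ∃ Z : Finset F, 28 ≤ Z.card ∧ ∀ z ∈ Z, z = 0 ∨ z ^ 27 + z ^ 18 + 1 = 0 := by
  have hdeg : ((X ^ 9 + 1) * (X ^ 27 + X ^ 9 + 1) : F[X]).natDegree = 36 := by
    compute_degree!
  have hq : ((X ^ 9 + 1) * (X ^ 27 + X ^ 9 + 1) : F[X]) ≠ 0 := fun h => by simp [h] at hdeg
  have hcard := card_sub_natDegree_le_card_filter hq
  rw [hF, hdeg] at hcard
  refine ⟨_, hcard, fun z hz => ?_⟩
  simp only [Finset.mem_filter, Finset.mem_univ, true_and] at hz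
  have hz64 := FiniteField.pow_card z
  rw [hF] at hz64
  rw [← mul_eq_zero]
  refine (mul_eq_zero.1 (?_ : eval z _ * _ = 0)).resolve_left hz
  simp only [eval_mul, eval_add, eval_pow, eval_X, eval_one]
  linear_combination hz64 + (z ^ 55 + z ^ 46 + 2 * z ^ 37 + 2 * z ^ 28 + z ^ 19 + z ^ 10 + z) *
    two_eq_zero hF

omit [Fintype F] in
lemma exists_translations (h2 : (2 : F) = 0) {w : F} (hw : w ^ 2 + w + 1 = 0) :
    ∃ T : Finset (F × F), T.card = 8 ∧ ∀ p ∈ T, p.1 ^ 4 = p.1 ∧ p.2 ^ 2 + p.2 = p.1 ^ 3 := by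
  have h0 : w ≠ 0 := by rintro rfl; simp at hw
  have h1 : w ≠ 1 := by
    rintro rfl
    exact one_ne_zero (by linear_combination hw - h2 : (1 : F) = 0)
  have h3 : w + 1 ≠ 0 := fun h => h1 (by linear_combination h - h2)
  have h4 : w ^ 3 = 1 := by linear_combination (w - 1) * hw
  refine ⟨{(0, 0), (0, 1), (1, w), (1, w + 1), (w, w), (w, w + 1), (w + 1, w),
    (w + 1, w + 1)}, ?_, ?_⟩
  · simp [h0, h0.symm, h1.symm, h3.symm]
  · intro p hp
    simp only [Finset.mem_insert, Finset.mem_singleton] at hp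
    rcases hp with rfl | rfl | rfl | rfl | rfl | rfl | rfl | rfl <;> constructor <;> dsimp only
    all_goals grind

lemma exists_points (hF : Fintype.card F = 64) :
    ∃ P : Fin 224 → F × F × F, Function.Injective P ∧ ∀ t, OnCurve (P t) := by
  have h2 := two_eq_zero hF
  obtain ⟨w, hw⟩ := exists_primitive_cube_root hF
  obtain ⟨Z, hZ, hZ'⟩ := exists_third_coordinates hF
  obtain ⟨T, hT, hT'⟩ := exists_translations h2 hw
  let f : F × F × F → F × F × F := fun p =>
    ((if p.1 = 0 then 0 else p.1 ^ 9 + w) + p.2.1 ^ 2 * p.1 ^ 12 + p.2.2, p.1 ^ 12 + p.2.1, p.1)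
  have hf : Function.Injective f := by
    rintro ⟨z, c, d⟩ ⟨z', c', d'⟩ h
    simp only [f, Prod.mk.injEq] at h
    obtain ⟨hx, hy, rfl⟩ := h
    obtain rfl := add_left_cancel hy
    rw [add_left_cancel hx]
  have hcurve : ∀ p ∈ Z ×ˢ T, OnCurve (f p) := by
    rintro ⟨z, c, d⟩ hp
    rw [Finset.mem_product] at hp
    obtain ⟨hc, hd⟩ := hT' _ hp.2
    have hz := hZ' _ hp.1
    dsimp only at hc hd hz
    by_cases hz0 : z = 0
    · simp only [OnCurve, f, hz0]
      constructor
      · simpa using hd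
      · simp only [ne_eq, OfNat.ofNat_ne_zero, not_false_eq_true, zero_pow, zero_add, hc]
        linear_combination c * h2
    · replace hz := hz.resolve_left hz0
      simp only [OnCurve, f, if_neg hz0]
      constructor
      · linear_combination hw + hd + z ^ 24 * hc - (z ^ 9 + 1) * hz +
          (z ^ 27 + z ^ 18 + z ^ 9 - z ^ 24 * c - c ^ 2 * z ^ 12 + z ^ 9 * w +
            z ^ 21 * c ^ 2 + z ^ 9 * d + w * c ^ 2 * z ^ 12 + w * d + c ^ 2 * z ^ 12 * d) * h2
      · linear_combination hc + z ^ 3 * (z ^ 18 + z ^ 9 + 1) * hz +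
          (c - z ^ 3 * (z ^ 36 + z ^ 27 + z ^ 18 + 1) + 2 * z ^ 36 * c + 3 * z ^ 24 * c ^ 2 +
            2 * z ^ 12 * c ^ 3) * h2
  have hcard : Fintype.card (Fin 224) ≤ (Z ×ˢ T).card := by
    rw [Fintype.card_fin, Finset.card_product, hT]
    omega
  rw [← Fintype.card_coe] at hcard
  obtain ⟨φ⟩ := Function.Embedding.nonempty_of_card_le hcard
  exact ⟨fun t => f (φ t), fun s t h => φ.injective (Subtype.ext (hf h)),
    fun t => hcurve _ (φ t).2⟩

end Points

end GKCode

open GKCode in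
theorem code_224_201_15
    (F : Type*) [Field F] [Fintype F] [DecidableEq F] (hF : Fintype.card F = 64) :
    ∃ C : Submodule F (Fin 224 → F),
      201 ≤ Module.finrank F C ∧
      ∀ x ∈ C, x ≠ 0 → 15 ≤ hammingNorm x := by
  obtain ⟨P, hinj, hP⟩ := exists_points hF
  let H : Matrix checks (Fin 224) F := Matrix.of fun a t => mon (P t) (exponents a)
  refine ⟨LinearMap.ker H.mulVecLin, ?_, fun c hc hc0 => ?_⟩
  · have h₁ := H.mulVecLin.finrank_range_add_finrank_ker
    have h₂ := Submodule.finrank_le (LinearMap.range H.mulVecLin)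
    rw [Module.finrank_fintype_fun_eq_card, Fintype.card_fin] at h₁
    rw [Module.finrank_fintype_fun_eq_card, Fintype.card_coe,
      show checks.card = 23 by decide] at h₂
    omega
  · have hex : ∃ n e, weight e = n ∧ ∑ t, c t * mon (P t) e ≠ 0 := by
      by_contra! h
      exact hc0 (eq_zero_of_forall_sum_mon_eq_zero hinj c fun e => h _ e rfl)
    classical
    obtain ⟨e, he, hne⟩ := Nat.find_spec hex
    have hlow (e' : ℕ × ℕ × ℕ) (he' : weight e' < Nat.find hex) :
        ∑ t, c t * mon (P t) e' = 0 := by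
      have := Nat.find_min hex he'
      push Not at this
      exact this e' rfl
    have hgap : Nat.find hex ∉ gaps := he ▸ weight_notMem_gaps e
    have hcheck : Nat.find hex ∉ checks := by
      intro hmem
      refine hne ?_
      rw [sum_mon_eq_of_weight_eq hP c hlow he (weight_exponents hgap)]
      rw [LinearMap.mem_ker] at hc
      refine Eq.trans ?_ (congrFun hc ⟨_, hmem⟩)
      simp only [Matrix.mulVecLin_apply, Matrix.mulVec, dotProduct, H, Matrix.of_apply]
      exact Finset.sum_congr rfl fun t _ => mul_comm _ _
    obtain ⟨A, hA, hA'⟩ := exists_fifteen_decompositions hgap hcheck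
    exact hA.trans (card_le_hammingNorm hP c hlow he hne A hA')
end

section
/- Let F be a finite field with 64 elements. There exists an F-linear subspace C of F^{224} of dimension 196 such that every nonzero element of C has Hamming weight at least 20; i.e., a linear [224, 196, ≥20]-code over F_{64} exists. -/
section Counting

open Polynomial

theorem charP_two_of_card_eq {F : Type*} [Field F] [Fintype F] (hF : Fintype.card F = 64) :
    CharP F 2 := by
  have h : (2 : F) ^ 6 = 0 := by
    have := FiniteField.cast_card_eq_zero F
    rw [hF] at this
    norm_num at this ⊢
    exact this
  exact CharTwo.of_one_ne_zero_of_two_eq_zero one_ne_zero (pow_eq_zero_iff (by norm_num) |>.1 h)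

theorem card_filter_eval_eq_zero_of_dvd {F : Type*} [Field F] [Fintype F] [DecidableEq F]
    {p : F[X]} (hp : p ∣ X ^ Fintype.card F - X) :
    (Finset.univ.filter fun x : F => p.eval x = 0).card = p.natDegree := by
  have h0 : (X ^ Fintype.card F - X : F[X]) ≠ 0 :=
    FiniteField.X_pow_card_sub_X_ne_zero F Fintype.one_lt_card
  have hp0 : p ≠ 0 := ne_zero_of_dvd_ne_zero h0 hp
  have hle : p.roots ≤ Finset.univ.val := by
    rw [← FiniteField.roots_X_pow_card_sub_X F]
    exact roots.le_of_dvd h0 hp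
  have hnd : p.roots.Nodup := Multiset.nodup_of_le hle Finset.univ.nodup
  have hs : (X ^ Fintype.card F - X : F[X]).Splits := by
    rw [splits_iff_card_roots, FiniteField.roots_X_pow_card_sub_X,
      FiniteField.X_pow_card_sub_X_natDegree_eq F Fintype.one_lt_card]
    rfl
  rw [(hs.of_dvd h0 hp).natDegree_eq_card_roots, ← Multiset.toFinset_card_of_nodup hnd]
  congr 1
  ext x
  simp [hp0]

variable {F : Type*} [Field F] [Fintype F] [DecidableEq F]

theorem card_artinSchreier_fiber (hF : Fintype.card F = 64) {c : F}
    (hc : c ^ 32 + c ^ 16 + c ^ 8 + c ^ 4 + c ^ 2 + c = 0) :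
    (Finset.univ.filter fun x : F => x ^ 2 + x = c).card = 2 := by
  have := charP_two_of_card_eq hF
  have hdvd : (X ^ 2 + X - C c : F[X]) ∣ X ^ Fintype.card F - X := by
    rw [hF]
    have hC : (C c : F[X]) ^ 32 + C c ^ 16 + C c ^ 8 + C c ^ 4 + C c ^ 2 + C c = 0 := by
      simp only [← C_pow, ← C_add, hc, C_0]
    generalize hw : (X ^ 2 + X - C c : F[X]) = w
    have h2 : w ^ 2 = X ^ 4 + X ^ 2 - C c ^ 2 := by grind
    have h4 : w ^ 4 = X ^ 8 + X ^ 4 - C c ^ 4 := by grind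
    have h8 : w ^ 8 = X ^ 16 + X ^ 8 - C c ^ 8 := by grind
    have h16 : w ^ 16 = X ^ 32 + X ^ 16 - C c ^ 16 := by grind
    have h32 : w ^ 32 = X ^ 64 + X ^ 32 - C c ^ 32 := by grind
    refine ⟨1 + w + w ^ 3 + w ^ 7 + w ^ 15 + w ^ 31, ?_⟩
    have : w * (1 + w + w ^ 3 + w ^ 7 + w ^ 15 + w ^ 31)
      = w ^ 32 + w ^ 16 + w ^ 8 + w ^ 4 + w ^ 2 + w := by ring
    rw [this, h32, h16, h8, h4, h2, ← hw]
    linear_combination hC - (X ^ 32 + X ^ 16 + X ^ 8 + X ^ 4 + X ^ 2 + X) *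
      (CharTwo.two_eq_zero : (2 : F[X]) = 0)
  have h := card_filter_eval_eq_zero_of_dvd hdvd
  have hdeg : (X ^ 2 + X - C c : F[X]).natDegree = 2 := by compute_degree!
  rw [hdeg] at h
  simpa [sub_eq_zero] using h

theorem card_cube_fiber (hF : Fintype.card F = 64) {w : F} (hw : w ^ 21 = 1) :
    (Finset.univ.filter fun z : F => z ^ 3 = w).card = 3 := by
  have hdvd : (X ^ 3 - C w : F[X]) ∣ X ^ Fintype.card F - X := by
    have h : (X ^ 64 - X : F[X]) = ((X ^ 3) ^ 21 - C w ^ 21) * X := by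
      rw [← C_pow, hw, C_1]; ring
    rw [hF, h]
    exact (sub_dvd_pow_sub_pow _ _ 21).mul_right X
  have h := card_filter_eval_eq_zero_of_dvd hdvd
  have hdeg : (X ^ 3 - C w : F[X]).natDegree = 3 := by compute_degree!
  rw [hdeg] at h
  simpa [sub_eq_zero] using h

theorem card_filter_trace_cube_eq_zero (hF : Fintype.card F = 64) :
    40 ≤ (Finset.univ.filter fun y : F => (y ^ 3) ^ 32 + (y ^ 3) ^ 16 + (y ^ 3) ^ 8 + (y ^ 3) ^ 4
      + (y ^ 3) ^ 2 + y ^ 3 = 0).card := by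
  have := charP_two_of_card_eq hF
  let p : F[X] := X * (X ^ 39 + X ^ 33 + X ^ 27 + X ^ 24 + X ^ 21 + X ^ 18 + X ^ 12 + X ^ 6
    + X ^ 3 + 1)
  have hdvd : p ∣ X ^ Fintype.card F - X := by
    rw [hF]
    refine ⟨X ^ 24 + X ^ 18 + X ^ 9 + X ^ 3 + 1, ?_⟩
    simp only [p]
    grind
  have hdeg : p.natDegree = 40 := by
    simp only [p]
    ring_nf
    compute_degree!
  rw [← hdeg, ← card_filter_eval_eq_zero_of_dvd hdvd]
  refine Finset.card_le_card fun y hy => ?_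
  simp only [Finset.mem_filter, Finset.mem_univ, true_and, p, eval_mul, eval_add, eval_pow,
    eval_X, eval_one] at hy ⊢
  have h64 : y ^ 64 = y := hF ▸ FiniteField.pow_card y
  have h96 : (y ^ 3) ^ 32 = y ^ 33 := by
    calc (y ^ 3) ^ 32 = y ^ 64 * y ^ 32 := by ring
      _ = y ^ 33 := by rw [h64]; ring
  rw [h96]
  grind

theorem pow_twentyone_eq_one {F : Type*} [Field F] [Fintype F] [CharP F 2]
    (hF : Fintype.card F = 64) {y : F}
    (hy : (y ^ 3) ^ 32 + (y ^ 3) ^ 16 + (y ^ 3) ^ 8 + (y ^ 3) ^ 4 + (y ^ 3) ^ 2 + y ^ 3 = 0)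
    (h : y ^ 4 + y ≠ 0) : (y ^ 4 + y) ^ 21 = 1 := by
  have h64 : y ^ 64 = y := hF ▸ FiniteField.pow_card y
  have h96 : (y ^ 3) ^ 32 = y ^ 33 := by
    calc (y ^ 3) ^ 32 = y ^ 64 * y ^ 32 := by ring
      _ = y ^ 33 := by rw [h64]; ring
  rw [h96] at hy
  have h4 : (y ^ 4 + y) ^ 4 = y ^ 16 + y ^ 4 := by grind
  have h16 : (y ^ 4 + y) ^ 16 = y + y ^ 16 := by
    calc (y ^ 4 + y) ^ 16 = y ^ 64 + y ^ 16 := by clear h64 hy h96; grind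
      _ = y + y ^ 16 := by rw [h64]
  have : (y ^ 4 + y) ^ 21 = (y + y ^ 16) * (y ^ 16 + y ^ 4) * (y ^ 4 + y) := by
    rw [← h4, ← h16]; ring
  rw [this]
  grind

theorem card_filter_pow_four_add_self_eq_zero (F : Type*) [Field F] [Fintype F] [DecidableEq F] :
    (Finset.univ.filter fun y : F => y ^ 4 + y = 0).card ≤ 4 := by
  have hdeg : (X ^ 4 + X : F[X]).natDegree = 4 := by compute_degree!
  have h0 : (X ^ 4 + X : F[X]) ≠ 0 := by
    intro h
    simp [h] at hdeg
  refine le_trans (Finset.card_le_card (t := (X ^ 4 + X : F[X]).roots.toFinset) fun y hy => ?_)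
    (((Multiset.toFinset_card_le _).trans (card_roots' _)).trans hdeg.le)
  simpa [h0] using hy

theorem exists_gk_points (hF : Fintype.card F = 64) :
    ∃ x y z : Fin 224 → F, (∀ i, x i ^ 2 + x i = y i ^ 3) ∧ (∀ i, z i ^ 3 = y i ^ 4 + y i) ∧
      ∀ i j, x i = x j → y i = y j → z i = z j → i = j := by
  have := charP_two_of_card_eq hF
  let S : Finset (Σ _ : F, F × F) := Finset.univ.sigma fun y =>
    (Finset.univ.filter fun x : F => x ^ 2 + x = y ^ 3) ×ˢ
      (Finset.univ.filter fun z : F => z ^ 3 = y ^ 4 + y)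
  let Y : Finset F := Finset.univ.filter fun y : F => (y ^ 3) ^ 32 + (y ^ 3) ^ 16 + (y ^ 3) ^ 8 +
    (y ^ 3) ^ 4 + (y ^ 3) ^ 2 + y ^ 3 = 0
  have hS : 224 ≤ S.card := by
    have hfib : ∀ y ∈ Y, (if y ^ 4 + y = 0 then 2 else 6) ≤
        ((Finset.univ.filter fun x : F => x ^ 2 + x = y ^ 3) ×ˢ
          (Finset.univ.filter fun z : F => z ^ 3 = y ^ 4 + y)).card := by
      intro y hy
      simp only [Y, Finset.mem_filter, Finset.mem_univ, true_and] at hy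
      rw [Finset.card_product, card_artinSchreier_fiber hF hy]
      split_ifs with h
      · have : 0 < (Finset.univ.filter fun z : F => z ^ 3 = y ^ 4 + y).card :=
          Finset.card_pos.2 ⟨0, by simp [h]⟩
        omega
      · rw [card_cube_fiber hF (pow_twentyone_eq_one hF hy h)]
    have hsum : ∑ y ∈ Y, (if y ^ 4 + y = 0 then 2 else 6) ≤ S.card := by
      rw [Finset.card_sigma]
      exact (Finset.sum_le_sum hfib).trans
        (Finset.sum_le_sum_of_subset (Finset.subset_univ _))
    have hY : 40 ≤ Y.card := card_filter_trace_cube_eq_zero hF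
    have h4 : (Y.filter fun y => y ^ 4 + y = 0).card ≤ 4 :=
      (Finset.card_le_card (Finset.filter_subset_filter _ (Finset.subset_univ _))).trans
        (card_filter_pow_four_add_self_eq_zero F)
    have hsplit := Finset.card_filter_add_card_filter_not (s := Y) fun y => y ^ 4 + y = 0
    rw [Finset.sum_ite, Finset.sum_const, Finset.sum_const, smul_eq_mul, smul_eq_mul] at hsum
    omega
  obtain ⟨e⟩ : Nonempty (Fin 224 ↪ S) :=
    Function.Embedding.nonempty_of_card_le (by simpa using hS)
  have he : ∀ i, (e i).1.2.1 ^ 2 + (e i).1.2.1 = (e i).1.1 ^ 3 ∧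
      (e i).1.2.2 ^ 3 = (e i).1.1 ^ 4 + (e i).1.1 := by
    intro i
    have h := (e i).2
    simpa only [S, Finset.mem_sigma, Finset.mem_product, Finset.mem_filter, Finset.mem_univ,
      true_and] using h
  refine ⟨fun i => (e i).1.2.1, fun i => (e i).1.1, fun i => (e i).1.2.2, fun i => (he i).1,
    fun i => (he i).2, fun i j hx hy hz => e.injective (Subtype.ext ?_)⟩
  exact Sigma.ext hy (heq_of_eq (Prod.ext hx hz))

end Counting

section OrderBound

variable {ι F : Type*} [Field F]

/-- The monomial `x ^ a * y ^ b * z ^ c`, evaluated at a family of points of the GK curve. -/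
def gkMonomial (x y z : ι → F) (a b c : ℕ) : ι → F := x ^ a * y ^ b * z ^ c

theorem gkMonomial_mul (x y z : ι → F) (a b c a' b' c' : ℕ) :
    gkMonomial x y z a b c * gkMonomial x y z a' b' c' =
      gkMonomial x y z (a + a') (b + b') (c + c') := by
  simp only [gkMonomial]
  ring

/-- Membership in the numerical semigroup generated by `6`, `8` and `9`. -/
def IsPoleOrder (k : ℕ) : Prop := 9 * (k % 2) + 8 * (2 * k % 3) ≤ k

instance : DecidablePred IsPoleOrder := fun k => inferInstanceAs (Decidable (_ ≤ k))

/-- The reduced monomial with pole order `k`, for `k` in the semigroup. -/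
def gkBasis (x y z : ι → F) (k : ℕ) : ι → F :=
  gkMonomial x y z (k % 2) ((k - 9 * (k % 2) - 8 * (2 * k % 3)) / 6) (2 * k % 3)

theorem weight_gkBasis {k : ℕ} (hk : IsPoleOrder k) :
    9 * (k % 2) + 6 * ((k - 9 * (k % 2) - 8 * (2 * k % 3)) / 6) + 8 * (2 * k % 3) = k := by
  unfold IsPoleOrder at hk
  omega

theorem gkMonomial_sub_gkBasis_mem {x y z : ι → F} (hx : x ^ 2 + x = y ^ 3)
    (hz : z ^ 3 = y ^ 4 + y) {m : ℕ} {W : Submodule F (ι → F)}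
    (hW : ∀ a b c, 9 * a + 6 * b + 8 * c < m → gkMonomial x y z a b c ∈ W) (a b c : ℕ)
    (h : 9 * a + 6 * b + 8 * c = m) :
    IsPoleOrder m ∧ gkMonomial x y z a b c - gkBasis x y z m ∈ W := by
  by_cases ha : 2 ≤ a
  · obtain ⟨a, rfl⟩ := Nat.exists_eq_add_of_le' ha
    have ih := gkMonomial_sub_gkBasis_mem hx hz hW a (b + 3) c (by omega)
    have hlow := hW (a + 1) b c (by omega)
    refine ⟨ih.1, ?_⟩
    convert W.sub_mem ih.2 hlow using 1
    simp only [gkMonomial]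
    linear_combination x ^ a * y ^ b * z ^ c * hx
  by_cases hc : 3 ≤ c
  · obtain ⟨c, rfl⟩ := Nat.exists_eq_add_of_le' hc
    have ih := gkMonomial_sub_gkBasis_mem hx hz hW a (b + 4) c (by omega)
    have hlow := hW a (b + 1) c (by omega)
    refine ⟨ih.1, ?_⟩
    convert W.add_mem ih.2 hlow using 1
    simp only [gkMonomial]
    linear_combination x ^ a * y ^ b * z ^ c * hz
  have ha' : m % 2 = a := by omega
  have hc' : 2 * m % 3 = c := by omega
  have hb' : (m - 9 * a - 8 * c) / 6 = b := by omega
  refine ⟨by unfold IsPoleOrder; omega, ?_⟩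
  rw [gkBasis, ha', hc', hb', sub_self]
  exact W.zero_mem
termination_by a + c

theorem gkMonomial_mem_span_gkBasis {x y z : ι → F} (hx : x ^ 2 + x = y ^ 3)
    (hz : z ^ 3 = y ^ 4 + y) {n : ℕ} (a b c : ℕ) (h : 9 * a + 6 * b + 8 * c < n) :
    gkMonomial x y z a b c ∈
      Submodule.span F (gkBasis x y z '' {k | k < n ∧ IsPoleOrder k}) := by
  generalize hm : 9 * a + 6 * b + 8 * c = m at h
  induction m using Nat.strong_induction_on generalizing a b c with
  | _ m ih =>
    obtain ⟨hm', hmem⟩ := gkMonomial_sub_gkBasis_mem hx hz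
      (fun a' b' c' h' => ih _ h' a' b' c' rfl (h'.trans h)) a b c hm
    have hbasis : gkBasis x y z m ∈
        Submodule.span F (gkBasis x y z '' {k | k < n ∧ IsPoleOrder k}) :=
      Submodule.subset_span ⟨m, ⟨h, hm'⟩, rfl⟩
    exact (Submodule.sub_mem_iff_left _ hbasis).1 hmem

theorem span_gkMonomial_eq_top [Fintype F] [Finite ι] {x y z : ι → F}
    (hinj : ∀ i j, x i = x j → y i = y j → z i = z j → i = j) :
    Submodule.span F (Set.range fun t : ℕ × ℕ × ℕ => gkMonomial x y z t.1 t.2.1 t.2.2) = ⊤ := by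
  classical
  have := Fintype.ofFinite ι
  set M := Submodule.span F (Set.range fun t : ℕ × ℕ × ℕ => gkMonomial x y z t.1 t.2.1 t.2.2)
  let A : Subalgebra F (ι → F) := Algebra.adjoin F {x, y, z}
  have hA : Subalgebra.toSubmodule A ≤ M := by
    rw [Algebra.adjoin_eq_span]
    refine Submodule.span_mono fun f hf => ?_
    induction hf using Submonoid.closure_induction with
    | mem f hf =>
      rcases hf with rfl | rfl | rfl
      · exact ⟨(1, 0, 0), by simp [gkMonomial]⟩
      · exact ⟨(0, 1, 0), by simp [gkMonomial]⟩
      · exact ⟨(0, 0, 1), by simp [gkMonomial]⟩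
    | one => exact ⟨(0, 0, 0), by simp [gkMonomial]⟩
    | mul f g _ _ hf hg =>
      obtain ⟨s, rfl⟩ := hf
      obtain ⟨t, rfl⟩ := hg
      exact ⟨(s.1 + t.1, s.2.1 + t.2.1, s.2.2 + t.2.2), (gkMonomial_mul ..).symm⟩
  have hsep : ∀ f ∈ A, ∀ i, 1 - (f - algebraMap F (ι → F) (f i)) ^ (Fintype.card F - 1) ∈ A :=
    fun f hf i => A.sub_mem A.one_mem (A.pow_mem (A.sub_mem hf (A.algebraMap_mem _)) _)
  have hval : ∀ (f : ι → F) (i j : ι),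
      (1 - (f - algebraMap F (ι → F) (f i)) ^ (Fintype.card F - 1)) j =
        if f i = f j then 1 else 0 := by
    intro f i j
    have h1 : Fintype.card F - 1 ≠ 0 := by
      have := Fintype.one_lt_card (α := F)
      omega
    split_ifs with h
    · simp [h, h1]
    · have h2 : f j - f i ≠ 0 := sub_ne_zero.2 (Ne.symm h)
      simp [FiniteField.pow_card_sub_one_eq_one _ h2]
  have hsingle : ∀ i, Pi.single i (1 : F) ∈ M := by
    intro i
    refine hA ?_
    have hx : x ∈ A := Algebra.subset_adjoin (by simp)
    have hy : y ∈ A := Algebra.subset_adjoin (by simp)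
    have hz : z ∈ A := Algebra.subset_adjoin (by simp)
    have h := A.mul_mem (A.mul_mem (hsep x hx i) (hsep y hy i)) (hsep z hz i)
    convert (show _ ∈ Subalgebra.toSubmodule A from h) using 1
    ext j
    rw [Pi.mul_apply, Pi.mul_apply, hval, hval, hval, Pi.single_apply]
    by_cases hij : j = i
    · simp [hij]
    · have := mt (fun h : x i = x j ∧ y i = y j ∧ z i = z j => hinj j i h.1.symm h.2.1.symm
        h.2.2.symm) hij
      rw [if_neg hij]
      split_ifs <;> simp_all
  rw [eq_top_iff]
  intro f _
  rw [pi_eq_sum_univ' f]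
  exact M.sum_mem fun i _ => by
    convert M.smul_mem (f i) (hsingle i) using 1

theorem twenty_le_card_poleOrder_pairs {m : ℕ} (hm : 38 ≤ m) :
    20 ≤ ((Finset.range (m + 1)).filter fun a => IsPoleOrder a ∧ IsPoleOrder (m - a)).card := by
  rcases hm.eq_or_lt with rfl | hm
  · decide
  let G : Finset ℕ := {1, 2, 3, 4, 5, 7, 10, 11, 13, 19}
  have hG : ∀ k, k ∉ G → IsPoleOrder k := by
    intro k hk
    simp only [G, Finset.mem_insert, Finset.mem_singleton, not_or] at hk
    unfold IsPoleOrder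
    by_cases h : k < 25
    · interval_cases k <;> omega
    · omega
  have hsub : Finset.range (m + 1) \ (G ∪ G.image (m - ·)) ⊆
      (Finset.range (m + 1)).filter fun a => IsPoleOrder a ∧ IsPoleOrder (m - a) := by
    intro a ha
    simp only [Finset.mem_sdiff, Finset.mem_union, Finset.mem_image, not_or, Finset.mem_range,
      Finset.mem_filter] at ha ⊢
    refine ⟨ha.1, hG _ ha.2.1, hG _ fun h => ha.2.2 ⟨_, h, ?_⟩⟩
    omega
  have h1 := Finset.card_le_card hsub
  have h2 := Finset.le_card_sdiff (G ∪ G.image (m - ·)) (Finset.range (m + 1))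
  have h3 := Finset.card_union_le G (G.image (m - ·))
  have h4 : (G.image (m - ·)).card ≤ G.card := Finset.card_image_le
  have h5 : G.card = 10 := rfl
  rw [Finset.card_range] at h2
  omega

theorem twenty_le_hammingNorm [Fintype F] [DecidableEq F] [Fintype ι] {x y z : ι → F}
    (hx : x ^ 2 + x = y ^ 3) (hz : z ^ 3 = y ^ 4 + y)
    (hinj : ∀ i j, x i = x j → y i = y j → z i = z j → i = j) {w : ι → F} (hw : w ≠ 0)
    (hdual : ∀ k < 38, IsPoleOrder k → ∑ i, w i * gkBasis x y z k i = 0) :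
    20 ≤ hammingNorm w := by
  classical
  let φ : (ι → F) →ₗ[F] F := Fintype.linearCombination F w
  have hφ : ∀ f, φ f = ∑ i, f i * w i := fun f => Fintype.linearCombination_apply F w f
  have hex : ∃ m a b c, 9 * a + 6 * b + 8 * c = m ∧ φ (gkMonomial x y z a b c) ≠ 0 := by
    by_contra! h
    have hker : LinearMap.ker φ = ⊤ := by
      rw [eq_top_iff, ← span_gkMonomial_eq_top hinj, Submodule.span_le]
      rintro _ ⟨t, rfl⟩
      exact h _ _ _ _ rfl
    refine hw (funext fun i => ?_)
    have : φ (Pi.single i 1) = 0 := by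
      rw [LinearMap.ker_eq_top.1 hker, LinearMap.zero_apply]
    simpa [hφ, Pi.single_apply] using this
  obtain ⟨a₀, b₀, c₀, h₀, hne₀⟩ := Nat.find_spec hex
  have hlow : ∀ a b c, 9 * a + 6 * b + 8 * c < Nat.find hex → φ (gkMonomial x y z a b c) = 0 := by
    intro a b c h
    by_contra h'
    exact Nat.find_min hex h ⟨a, b, c, rfl, h'⟩
  generalize Nat.find hex = m at h₀ hlow
  have hm : 38 ≤ m := by
    by_contra! hm
    have hspan : Submodule.span F (gkBasis x y z '' {k | k < 38 ∧ IsPoleOrder k}) ≤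
        LinearMap.ker φ := by
      rw [Submodule.span_le]
      rintro _ ⟨k, ⟨hk, hk'⟩, rfl⟩
      simp only [SetLike.mem_coe, LinearMap.mem_ker, hφ]
      simpa only [mul_comm] using hdual k hk hk'
    exact hne₀ (hspan (gkMonomial_mem_span_gkBasis hx hz a₀ b₀ c₀ (h₀.trans_lt hm)))
  have htop : ∀ a b c, 9 * a + 6 * b + 8 * c = m → φ (gkMonomial x y z a b c) ≠ 0 := by
    intro a b c h
    have h1 := (gkMonomial_sub_gkBasis_mem (W := LinearMap.ker φ) hx hz hlow a b c h).2
    have h2 := (gkMonomial_sub_gkBasis_mem (W := LinearMap.ker φ) hx hz hlow a₀ b₀ c₀ h₀).2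
    rw [LinearMap.mem_ker, map_sub, sub_eq_zero] at h1 h2
    rwa [h1, ← h2]
  let T := (Finset.range (m + 1)).filter fun a => IsPoleOrder a ∧ IsPoleOrder (m - a)
  let S := Finset.univ.filter fun i => w i ≠ 0
  have hli : LinearIndependent F fun (a : T) (i : S) => gkBasis x y z a i := by
    rw [Fintype.linearIndependent_iff]
    intro g hg
    by_contra! hne
    obtain ⟨a, ha, hmax⟩ := (Finset.univ.filter fun a => g a ≠ 0).exists_max_image
      (fun a : T => (a : ℕ)) (by obtain ⟨a, ha⟩ := hne; exact ⟨a, by simpa using ha⟩)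
    simp only [Finset.mem_filter, Finset.mem_univ, true_and] at ha hmax
    have hT : ∀ b : T, (b : ℕ) ≤ m ∧ IsPoleOrder b ∧ IsPoleOrder (m - b) := by
      intro b
      have h := b.2
      simp only [T, Finset.mem_filter, Finset.mem_range] at h
      exact ⟨by omega, h.2⟩
    have hzero : φ ((∑ b, g b • gkBasis x y z b) * gkBasis x y z (m - a)) = 0 := by
      rw [hφ]
      refine Finset.sum_eq_zero fun i _ => ?_
      by_cases hi : w i = 0
      · rw [hi, mul_zero]
      · have h := congrFun hg ⟨i, by simpa [S] using hi⟩
        simp only [Finset.sum_apply, Pi.smul_apply, Pi.zero_apply] at h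
        simp only [smul_eq_mul] at h
        rw [Pi.mul_apply, Finset.sum_apply]
        simp only [Pi.smul_apply, smul_eq_mul, h, zero_mul]
    rw [Finset.sum_mul, map_sum, Finset.sum_eq_single a] at hzero
    · rw [smul_mul_assoc, map_smul, smul_eq_mul, gkBasis, gkBasis, gkMonomial_mul] at hzero
      refine (mul_ne_zero ha (htop _ _ _ ?_)) hzero
      have h1 := weight_gkBasis (hT a).2.1
      have h2 := weight_gkBasis (hT a).2.2
      have h3 := (hT a).1
      generalize (_ / 6) = p at *
      generalize (_ / 6) = q at *
      omega
    · intro b _ hba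
      rw [smul_mul_assoc, map_smul, smul_eq_mul]
      by_cases hb : g b = 0
      · rw [hb, zero_mul]
      · have hlt : (b : ℕ) < a := lt_of_le_of_ne (hmax b hb) fun h => hba (Subtype.ext h)
        rw [gkBasis, gkBasis, gkMonomial_mul, hlow, mul_zero]
        have h1 := weight_gkBasis (hT b).2.1
        have h2 := weight_gkBasis (hT a).2.2
        have h3 := (hT a).1
        omega
    · simp
  have hcard := hli.fintype_card_le_finrank
  rw [Module.finrank_fintype_fun_eq_card, Fintype.card_coe, Fintype.card_coe] at hcard
  exact (twenty_le_card_poleOrder_pairs hm).trans hcard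

end OrderBound

theorem code_224_196_20
    (F : Type*) [Field F] [Fintype F] [DecidableEq F] (hF : Fintype.card F = 64) :
    ∃ C : Submodule F (Fin 224 → F),
      Module.finrank F C = 196 ∧
      ∀ x ∈ C, x ≠ 0 → 20 ≤ hammingNorm x := by
  obtain ⟨x, y, z, hx, hz, hinj⟩ := exists_gk_points hF
  let K := (Finset.range 38).filter IsPoleOrder
  let H : (Fin 224 → F) →ₗ[F] K → F :=
    LinearMap.pi fun k => Fintype.linearCombination F (gkBasis x y z k)
  have hK : K.card = 28 := by decide
  have hker : 196 ≤ Module.finrank F (LinearMap.ker H) := by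
    have h1 := LinearMap.finrank_range_add_finrank_ker H
    have h2 := Submodule.finrank_le (LinearMap.range H)
    simp only [Module.finrank_fintype_fun_eq_card, Fintype.card_coe, hK, Fintype.card_fin] at h1 h2
    omega
  obtain ⟨C, hC, hdim⟩ : ∃ C : Submodule F (Fin 224 → F), C ≤ LinearMap.ker H ∧
      Module.finrank F C = 196 := by
    obtain ⟨v, hv⟩ := exists_linearIndependent_of_le_finrank hker
    have hv' := hv.map' (LinearMap.ker H).subtype (Submodule.ker_subtype _)
    refine ⟨Submodule.span F (Set.range ((LinearMap.ker H).subtype ∘ v)), ?_, ?_⟩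
    · rw [Submodule.span_le]
      rintro _ ⟨i, rfl⟩
      exact (v i).2
    · rw [finrank_span_eq_card hv', Fintype.card_fin]
  refine ⟨C, hdim, fun w hw hw0 => twenty_le_hammingNorm (funext hx) (funext hz) hinj hw0 ?_⟩
  intro k hk hk'
  have h := congrFun (LinearMap.mem_ker.1 (hC hw)) ⟨k, by simp [K, hk, hk']⟩
  simpa [H, Fintype.linearCombination_apply] using h
end
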